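/- For every preference profile P that is single-peaked with respect to ≺, there exists a bijection g from the set of endowment profiles onto the set of orders on N such that for every endowment profile ω, the sequential priority rule induced by g(ω) selects the crawler allocation: SP^{g(ω)}(P) = CR(P,ω). -/

import Mathlib

/- Preferences are given by rank functions: `rk i o` is agent `i`'s rank of object `o`
(lower rank = more preferred), so `o P_i o'` iff `rk i o < rk i o'`. -/

/-- Find the smallest index `t` such that the `t`-th agent prefers the `t`-th object
to the `(t+1)`-st object; the last index always qualifies. -/
def findIdx2 {n : ℕ} (rk : Fin n → Fin n → Fin n) : List (Fin n) → List (Fin n) → ℕ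
  | a :: as, o1 :: o2 :: os =>
      if rk a o1 < rk a o2 then 0 else findIdx2 rk as (o2 :: os) + 1
  | _, _ => 0

/-- One run of the (ascending) crawler: `agents` is the list of remaining agents in the
order of their current ownership, `objects` the list of remaining objects in increasing
`≺`-order (the `t`-th agent currently owns the `t`-th object). -/
def crawlAux {n : ℕ} (rk : Fin n → Fin n → Fin n) :
    ℕ → List (Fin n) → List (Fin n) → List (Fin n × Fin n)
  | 0, _, _ => []
  | fuel + 1, agents, objects =>
    match agents, objects with
    | a0 :: _, o0 :: _ =>
      let t := findIdx2 rk agents objects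
      let a := agents.getD t a0
      let ostar := (objects.argmin (rk a)).getD o0
      (a, ostar) :: crawlAux rk fuel (agents.eraseIdx t) (objects.erase ostar)
    | _, _ => []

/-- Agents listed in increasing order of their endowments. -/
def ownersList {n : ℕ} (ω : Fin n → Fin n) : List (Fin n) :=
  (List.finRange n).filterMap fun o => (List.finRange n).find? fun a => ω a == o

/-- The (ascending) crawler allocation. -/
def CRfun {n : ℕ} (rk : Fin n → Fin n → Fin n) (ω : Fin n → Fin n) (i : Fin n) : Fin n :=
  ((crawlAux rk n (ownersList ω) (List.finRange n)).lookup i).getD (ω i)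

/-- The descending crawler: the mirror image of the ascending crawler, obtained by
reversing the order `≺` on objects. -/
def DCRfun {n : ℕ} (rk : Fin n → Fin n → Fin n) (ω : Fin n → Fin n) (i : Fin n) : Fin n :=
  Fin.rev (CRfun (fun j o => rk j o.rev) (fun j => (ω j).rev) i)

/-- Sequential priority: agents in the given list pick, in order, their most
preferred remaining object. -/
def SPAux {n : ℕ} (rk : Fin n → Fin n → Fin n) :
    List (Fin n) → List (Fin n) → List (Fin n × Fin n)
  | [], _ => []
  | _ :: _, [] => []
  | a :: as, o0 :: os =>
      let o := ((o0 :: os).argmin (rk a)).getD o0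
      (a, o) :: SPAux rk as ((o0 :: os).erase o)

/-- The sequential priority rule induced by the order `f` (agent `f k` has priority `k`). -/
def SPfun {n : ℕ} (rk : Fin n → Fin n → Fin n) (f : Fin n → Fin n) (i : Fin n) : Fin n :=
  ((SPAux rk ((List.finRange n).map f) (List.finRange n)).lookup i).getD i

/-- Top trading cycles: `own` maps each remaining object to its (initial) owner. -/
def TTCAux {n : ℕ} (rk : Fin n → Fin n → Fin n) :
    ℕ → List (Fin n) → List (Fin n) → (Fin n → Fin n) → List (Fin n × Fin n)
  | 0, _, _, _ => []
  | fuel + 1, agents, objects, own =>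
    match agents with
    | [] => []
    | a0 :: _ =>
      let top : Fin n → Fin n := fun a => (objects.argmin (rk a)).getD a0
      let ptr : Fin n → Fin n := fun a => own (top a)
      let onCyc : Fin n → Bool := fun a =>
        (List.range agents.length).any fun k => ptr^[k + 1] a == a
      let cyc := agents.filter onCyc
      let assigned := cyc.map top
      (cyc.map fun a => (a, top a)) ++
        TTCAux rk fuel (agents.filter fun a => !onCyc a)
          (objects.filter fun o => !(assigned.contains o)) own

/-- The top trading cycles allocation from endowments `ω`. -/
def TTCfun {n : ℕ} (rk : Fin n → Fin n → Fin n) (ω : Equiv.Perm (Fin n)) (i : Fin n) : Fin n :=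
  ((TTCAux rk n (List.finRange n) (List.finRange n) ω.symm).lookup i).getD (ω i)

/-- A profile of strict preferences (given as rank permutations) is single-peaked
with respect to the order on `Fin n`. -/
def SinglePeaked {n : ℕ} (P : Fin n → Equiv.Perm (Fin n)) : Prop :=
  ∀ i : Fin n, ∃ p : Fin n, ∀ o o' : Fin n,
    ((o' < o ∧ o ≤ p) ∨ (p ≤ o ∧ o < o')) → P i o < P i o'

/-- Pareto efficiency of an allocation `x` at the profile `P`. -/
def ParetoEfficient {n : ℕ} (P : Fin n → Equiv.Perm (Fin n)) (x : Fin n → Fin n) : Prop :=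
  ¬ ∃ y : Equiv.Perm (Fin n),
      (∀ i, P i (y i) ≤ P i (x i)) ∧ ∃ j, P j (y j) < P j (x j)

/-- The object of `O` that agent `a` likes best. -/
noncomputable def topChoice {n : ℕ} (rk : Fin n → Fin n → Fin n) (a : Fin n)
    (O : Finset (Fin n)) : Fin n :=
  if h : O.Nonempty then (O.exists_min_image (rk a) h).choose else a

/-- The position of agent `a`'s best object in the increasing enumeration of `O`. -/
noncomputable def peakIdx {n : ℕ} (rk : Fin n → Fin n → Fin n) (a : Fin n)
    (O : Finset (Fin n)) : ℕ :=
  (O.filter (· < topChoice rk a O)).card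

/-- The preferences have no interior local worst point: this is what single-peakedness
amounts to for restrictions to arbitrary sets of objects. -/
def BetweenBetter {n : ℕ} (rk : Fin n → Fin n → Fin n) : Prop :=
  ∀ i x y z, x < y → y < z → rk i y < rk i x ∨ rk i y < rk i z

section Peaks

variable {n : ℕ} {rk : Fin n → Fin n → Fin n} {a c : Fin n} {O : Finset (Fin n)}

theorem topChoice_mem (h : O.Nonempty) : topChoice rk a O ∈ O := by
  rw [topChoice, dif_pos h]
  exact (O.exists_min_image (rk a) h).choose_spec.1

theorem rk_topChoice_le {x : Fin n} (hx : x ∈ O) : rk a (topChoice rk a O) ≤ rk a x := by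
  have h : O.Nonempty := ⟨x, hx⟩
  rw [topChoice, dif_pos h]
  exact (O.exists_min_image (rk a) h).choose_spec.2 x hx

theorem topChoice_eq (hinj : ∀ i, Function.Injective (rk i)) {o : Fin n} (ho : o ∈ O)
    (h : ∀ x ∈ O, rk a o ≤ rk a x) : topChoice rk a O = o :=
  hinj a (le_antisymm (rk_topChoice_le ho) (h _ (topChoice_mem ⟨o, ho⟩)))

theorem peakIdx_lt_card (h : O.Nonempty) : peakIdx rk a O < O.card :=
  Finset.card_lt_card (Finset.filter_ssubset.2 ⟨_, topChoice_mem h, lt_irrefl _⟩)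

theorem topChoice_erase (hinj : ∀ i, Function.Injective (rk i)) {o : Fin n}
    (hO : O.Nonempty) (ho : topChoice rk a O ≠ o) :
    topChoice rk a (O.erase o) = topChoice rk a O :=
  topChoice_eq hinj (Finset.mem_erase.2 ⟨ho, topChoice_mem hO⟩)
    fun _ hx => rk_topChoice_le (Finset.mem_of_mem_erase hx)

theorem peakIdx_lt_iff (hO : O.Nonempty) :
    peakIdx rk a O < peakIdx rk c O ↔ topChoice rk a O < topChoice rk c O := by
  constructor
  · intro h
    by_contra! h'
    refine absurd h (not_lt.2 (Finset.card_le_card fun x hx => ?_))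
    simp only [Finset.mem_filter] at hx ⊢
    exact ⟨hx.1, hx.2.trans_le h'⟩
  · intro h
    refine Finset.card_lt_card (Finset.ssubset_iff_of_subset (fun x hx => ?_) |>.2
      ⟨topChoice rk a O, ?_, ?_⟩)
    · simp only [Finset.mem_filter] at hx ⊢
      exact ⟨hx.1, hx.2.trans h⟩
    · simp [topChoice_mem hO, h]
    · simp

theorem topChoice_erase_of_peakIdx_ne (hinj : ∀ i, Function.Injective (rk i))
    (hO : O.Nonempty) (h : peakIdx rk a O ≠ peakIdx rk c O) :
    topChoice rk a (O.erase (topChoice rk c O)) = topChoice rk a O :=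
  topChoice_erase hinj hO fun h' => h (by rw [peakIdx, peakIdx, h'])

theorem peakIdx_erase_of_lt (hinj : ∀ i, Function.Injective (rk i))
    (hO : O.Nonempty) (h : peakIdx rk a O < peakIdx rk c O) :
    peakIdx rk a (O.erase (topChoice rk c O)) = peakIdx rk a O := by
  rw [peakIdx, topChoice_erase_of_peakIdx_ne hinj hO h.ne, peakIdx, Finset.filter_erase,
    Finset.erase_eq_of_notMem]
  simp [((peakIdx_lt_iff hO).1 h).le]

theorem peakIdx_erase_of_gt (hinj : ∀ i, Function.Injective (rk i))
    (hO : O.Nonempty) (h : peakIdx rk c O < peakIdx rk a O) :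
    peakIdx rk a (O.erase (topChoice rk c O)) + 1 = peakIdx rk a O := by
  rw [peakIdx, topChoice_erase_of_peakIdx_ne hinj hO h.ne', peakIdx, Finset.filter_erase,
    Finset.card_erase_add_one]
  simp [topChoice_mem hO, (peakIdx_lt_iff hO).1 h]

theorem peakIdx_erase_self (hb : BetweenBetter rk)
    (hO : (O.erase (topChoice rk a O)).Nonempty) :
    peakIdx rk a (O.erase (topChoice rk a O)) = peakIdx rk a O ∨
      peakIdx rk a (O.erase (topChoice rk a O)) + 1 = peakIdx rk a O := by
  have hmin := fun x (hx : x ∈ O) => rk_topChoice_le (rk := rk) (a := a) hx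
  have hmem := topChoice_mem (rk := rk) (a := a) hO
  have hmin' := fun x (hx : x ∈ O.erase (topChoice rk a O)) =>
    rk_topChoice_le (rk := rk) (a := a) hx
  simp only [peakIdx]
  generalize topChoice rk a (O.erase (topChoice rk a O)) = o' at *
  generalize topChoice rk a O = o at *
  obtain ⟨hne, hoO⟩ := Finset.mem_erase.1 hmem
  have key : ∀ x ∈ O, x ≠ o → ¬ (o' < x ∧ x < o) ∧ ¬ (o < x ∧ x < o') := by
    intro x hx hxo
    have h1 := hmin x hx
    have h2 := hmin' x (Finset.mem_erase.2 ⟨hxo, hx⟩)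
    constructor
    · rintro ⟨h3, h4⟩
      rcases hb a _ _ _ h3 h4 with h | h <;> order
    · rintro ⟨h3, h4⟩
      rcases hb a _ _ _ h3 h4 with h | h <;> order
  rcases lt_or_gt_of_ne hne with h | h
  · right
    rw [← Finset.card_insert_of_notMem (a := o') (by simp)]
    congr 1
    ext x
    simp only [Finset.mem_insert, Finset.mem_filter, Finset.mem_erase]
    constructor
    · rintro (rfl | ⟨⟨h1, h2⟩, h3⟩)
      · exact ⟨hoO, h⟩
      · exact ⟨h2, h3.trans h⟩
    · rintro ⟨h1, h2⟩
      have := (key x h1 h2.ne).1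
      by_cases hx : x = o'
      · exact Or.inl hx
      · refine Or.inr ⟨⟨h2.ne, h1⟩, ?_⟩
        by_contra! h3
        exact this ⟨lt_of_le_of_ne h3 (Ne.symm hx), h2⟩
  · left
    congr 1
    ext x
    simp only [Finset.mem_filter, Finset.mem_erase]
    constructor
    · rintro ⟨⟨h1, h2⟩, h3⟩
      refine ⟨h2, ?_⟩
      by_contra! h4
      exact (key x h2 h1).2 ⟨lt_of_le_of_ne h4 (Ne.symm h1), h3⟩
    · rintro ⟨h1, h2⟩
      exact ⟨⟨h2.ne, h1⟩, h2.trans h⟩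

/-- Removing another agent's best object moves a peak at most one position to the left. -/
theorem peakIdx_erase (hinj : ∀ i, Function.Injective (rk i)) (hb : BetweenBetter rk)
    (hO : (O.erase (topChoice rk c O)).Nonempty) :
    (peakIdx rk a O < peakIdx rk c O →
        peakIdx rk a (O.erase (topChoice rk c O)) = peakIdx rk a O) ∧
      (peakIdx rk c O < peakIdx rk a O →
        peakIdx rk a (O.erase (topChoice rk c O)) + 1 = peakIdx rk a O) ∧
      (peakIdx rk a (O.erase (topChoice rk c O)) = peakIdx rk a O ∨
        peakIdx rk a (O.erase (topChoice rk c O)) + 1 = peakIdx rk a O) := by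
  have hO' : O.Nonempty := hO.mono (Finset.erase_subset _ _)
  refine ⟨peakIdx_erase_of_lt hinj hO', peakIdx_erase_of_gt hinj hO', ?_⟩
  rcases lt_trichotomy (peakIdx rk a O) (peakIdx rk c O) with h | h | h
  · exact Or.inl (peakIdx_erase_of_lt hinj hO' h)
  · have h1 : topChoice rk c O = topChoice rk a O := by
      have h2 := (peakIdx_lt_iff (rk := rk) (a := a) (c := c) hO').not.1 h.not_lt
      have h3 := (peakIdx_lt_iff (rk := rk) (a := c) (c := a) hO').not.1 h.symm.not_lt
      order
    rw [h1] at hO ⊢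
    exact peakIdx_erase_self hb hO
  · exact Or.inr (peakIdx_erase_of_gt hinj hO' h)

end Peaks

/-- The first index `t` in the list, counted from `j`, such that the agent there has his peak
among the positions up to `t`; the result is relative to the start of the list. -/
noncomputable def stopIdx {n : ℕ} (rk : Fin n → Fin n → Fin n) (O : Finset (Fin n)) :
    ℕ → List (Fin n) → ℕ
  | _, [] => 0
  | j, a :: L => if peakIdx rk a O ≤ j then 0 else stopIdx rk O (j + 1) L + 1

/-- The crawler in which the agent at position `s` may take any object as soon as all agents
before him pass. It is sequential priority for `s = 0` and the crawler for large `s`. -/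
noncomputable def hybrid {n : ℕ} (rk : Fin n → Fin n → Fin n) :
    ℕ → ℕ → List (Fin n) → Finset (Fin n) → Multiset (Fin n × Fin n)
  | 0, _, _, _ => 0
  | _ + 1, _, [], _ => 0
  | k + 1, s, a₀ :: L, O =>
    let t := min s (stopIdx rk O 0 (a₀ :: L))
    let a := (a₀ :: L).getD t a₀
    (a, topChoice rk a O) ::ₘ
      hybrid rk k (if t < s then s - 1 else s) ((a₀ :: L).eraseIdx t) (O.erase (topChoice rk a O))

/-- All agents in `W` pass when the remaining objects are `O`. -/
def AllPass {n : ℕ} (rk : Fin n → Fin n → Fin n) (W : List (Fin n)) (O : Finset (Fin n)) : Prop :=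
  ∀ W₁ w W₂, W = W₁ ++ w :: W₂ → W₁.length < peakIdx rk w O

section Hybrid

variable {n : ℕ} {rk : Fin n → Fin n → Fin n} {O : Finset (Fin n)}

theorem AllPass.append_singleton {W : List (Fin n)} {a : Fin n} (h : AllPass rk W O)
    (ha : W.length < peakIdx rk a O) : AllPass rk (W ++ [a]) O := by
  intro W₁ w W₂ heq
  rcases List.eq_nil_or_concat W₂ with rfl | ⟨W₃, b, rfl⟩
  · obtain ⟨rfl, h2⟩ := List.append_inj' heq rfl
    simp_all
  · rw [List.concat_eq_append, ← List.cons_append, ← List.append_assoc] at heq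
    obtain ⟨rfl, -⟩ := List.append_inj' heq rfl
    exact h W₁ w W₃ rfl

theorem allPass_or_exists_pick (W : List (Fin n)) :
    AllPass rk W O ∨ ∃ W₁ w W₂, W = W₁ ++ w :: W₂ ∧ AllPass rk W₁ O ∧
      peakIdx rk w O ≤ W₁.length := by
  induction W using List.reverseRecOn with
  | nil => exact Or.inl fun W₁ w W₂ h => by simp at h
  | append_singleton W a ih =>
    rcases ih with h | ⟨W₁, w, W₂, rfl, h1, h2⟩
    · by_cases ha : W.length < peakIdx rk a O
      · exact Or.inl (h.append_singleton ha)
      · exact Or.inr ⟨W, a, [], rfl, h, not_lt.1 ha⟩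
    · exact Or.inr ⟨W₁, w, W₂ ++ [a], by simp, h1, h2⟩

theorem forall_split_cons_iff {a : Fin n} {W : List (Fin n)} {j : ℕ} :
    (∀ W₁ w W₂, a :: W = W₁ ++ w :: W₂ → W₁.length + j < peakIdx rk w O) ↔
      j < peakIdx rk a O ∧
        ∀ W₁ w W₂, W = W₁ ++ w :: W₂ → W₁.length + (j + 1) < peakIdx rk w O := by
  constructor
  · intro h
    refine ⟨by simpa using h [] a W rfl, ?_⟩
    rintro W₁ w W₂ rfl
    have := h (a :: W₁) w W₂ rfl
    simp only [List.length_cons] at this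
    omega
  · rintro ⟨h1, h2⟩ W₁ w W₂ heq
    cases W₁ with
    | nil => simp_all
    | cons b W₁ =>
      simp only [List.cons_append, List.cons.injEq] at heq
      have := h2 W₁ w W₂ heq.2
      simp only [List.length_cons]
      omega

theorem stopIdx_append {W L : List (Fin n)} {j : ℕ}
    (h : ∀ W₁ w W₂, W = W₁ ++ w :: W₂ → W₁.length + j < peakIdx rk w O) :
    stopIdx rk O j (W ++ L) = W.length + stopIdx rk O (j + W.length) L := by
  induction W generalizing j with
  | nil => simp
  | cons a W ih =>
    obtain ⟨h1, h2⟩ := forall_split_cons_iff.1 h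
    rw [List.cons_append, stopIdx, if_neg (by omega), ih h2]
    simp only [List.length_cons]
    rw [add_assoc j 1, add_comm 1 W.length]
    omega

theorem hybrid_of_min_stopIdx_eq {k s : ℕ} {L₁ L₂ : List (Fin n)} {a : Fin n}
    (h : min s (stopIdx rk O 0 (L₁ ++ a :: L₂)) = L₁.length) :
    hybrid rk (k + 1) s (L₁ ++ a :: L₂) O = (a, topChoice rk a O) ::ₘ
      hybrid rk k (if L₁.length < s then s - 1 else s) (L₁ ++ L₂)
        (O.erase (topChoice rk a O)) := by
  obtain ⟨a₀, L, hL⟩ : ∃ a₀ L, L₁ ++ a :: L₂ = a₀ :: L := by cases L₁ <;> simp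
  have h1 : (a₀ :: L).getD L₁.length a₀ = a := by
    rw [← hL]; simp
  have h2 : (a₀ :: L).eraseIdx L₁.length = L₁ ++ L₂ := by
    rw [← hL, List.eraseIdx_append_of_length_le le_rfl]; simp
  rw [hL] at h ⊢
  simp only [hybrid, h, h1, h2]

theorem hybrid_of_pick {k s : ℕ} {W₁ W₂ : List (Fin n)} {w : Fin n} (hs : W₁.length ≤ s)
    (hW : AllPass rk W₁ O) (hw : peakIdx rk w O ≤ W₁.length) :
    hybrid rk (k + 1) (s + 1) (W₁ ++ w :: W₂) O = (w, topChoice rk w O) ::ₘ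
      hybrid rk k s (W₁ ++ W₂) (O.erase (topChoice rk w O)) := by
  rw [hybrid_of_min_stopIdx_eq, if_pos (by omega), Nat.add_sub_cancel]
  rw [stopIdx_append (j := 0) hW, stopIdx, if_pos (by omega)]
  omega

theorem hybrid_of_allPass {k : ℕ} {W L : List (Fin n)} {a : Fin n} (hW : AllPass rk W O) :
    hybrid rk (k + 1) W.length (W ++ a :: L) O = (a, topChoice rk a O) ::ₘ
      hybrid rk k W.length (W ++ L) (O.erase (topChoice rk a O)) := by
  rw [hybrid_of_min_stopIdx_eq, if_neg (by omega)]
  rw [stopIdx_append (j := 0) hW]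
  omega

theorem AllPass.erase (hinj : ∀ i, Function.Injective (rk i)) (hb : BetweenBetter rk)
    {W : List (Fin n)} {c : Fin n} (hW : AllPass rk W O) (hc : W.length < peakIdx rk c O)
    (hO : (O.erase (topChoice rk c O)).Nonempty) : AllPass rk W (O.erase (topChoice rk c O)) := by
  rintro W₁ w W₂ rfl
  have h1 := hW W₁ w W₂ rfl
  have h2 := peakIdx_erase (a := w) hinj hb hO
  simp only [List.length_append, List.length_cons] at hc
  omega

theorem erase_topChoice_nonempty {a : Fin n} (h : 1 < O.card) :
    (O.erase (topChoice rk a O)).Nonempty := by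
  rw [← Finset.card_pos]
  have := Finset.pred_card_le_card_erase (s := O) (a := topChoice rk a O)
  omega

theorem card_erase_topChoice {a : Fin n} {m : ℕ} (h : O.card = m + 1) :
    (O.erase (topChoice rk a O)).card = m := by
  rw [Finset.card_erase_of_mem (topChoice_mem (Finset.card_pos.1 (by omega))), h,
    Nat.add_sub_cancel]

theorem hybrid_succ_eq_of_peakIdx_le (hinj : ∀ i, Function.Injective (rk i))
    (hb : BetweenBetter rk) {m : ℕ} {W ρ : List (Fin n)} {a : Fin n} (hO : O.card = m)
    (hm : W.length < m) (ha : peakIdx rk a O ≤ W.length) :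
    hybrid rk m (W.length + 1) (W ++ a :: ρ) O = hybrid rk m W.length (W ++ a :: ρ) O := by
  induction m generalizing W O with
  | zero => rfl
  | succ m ih =>
    rcases allPass_or_exists_pick (rk := rk) (O := O) W with h | ⟨W₁, w, W₂, rfl, h1, h2⟩
    · rw [hybrid_of_pick le_rfl h ha, hybrid_of_allPass h]
    · simp only [List.length_append, List.length_cons] at hm ha
      have hE := peakIdx_erase (a := a) hinj hb
        (erase_topChoice_nonempty (rk := rk) (O := O) (a := w) (by omega))
      have := ih (W := W₁ ++ W₂) (card_erase_topChoice (rk := rk) (a := w) hO)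
        (by simp; omega) (by simp; omega)
      simp only [List.append_assoc, List.cons_append, List.length_append, List.length_cons]
        at this ⊢
      rw [← add_assoc, hybrid_of_pick (by omega) h1 h2, hybrid_of_pick (by omega) h1 h2, this]

theorem hybrid_eq_cons_of_le_peakIdx (hinj : ∀ i, Function.Injective (rk i))
    (hb : BetweenBetter rk) {m : ℕ} {W ρ : List (Fin n)} {a : Fin n} (hO : O.card = m + 1)
    (hm : W.length ≤ m) (ha : W.length ≤ peakIdx rk a O) :
    hybrid rk (m + 1) W.length (W ++ a :: ρ) O = (a, topChoice rk a O) ::ₘ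
      hybrid rk m W.length (W ++ ρ) (O.erase (topChoice rk a O)) := by
  induction m generalizing W O with
  | zero =>
    obtain rfl : W = [] := by simpa using hm
    exact hybrid_of_allPass fun W₁ w W₂ h => by simp at h
  | succ m ih =>
    rcases allPass_or_exists_pick (rk := rk) (O := O) W with h | ⟨W₁, w, W₂, rfl, h1, h2⟩
    · exact hybrid_of_allPass h
    · simp only [List.length_append, List.length_cons] at hm ha
      have hO' : O.Nonempty := Finset.card_pos.1 (by omega)
      have hEw := erase_topChoice_nonempty (rk := rk) (O := O) (a := w) (by omega)
      have hEa := erase_topChoice_nonempty (rk := rk) (O := O) (a := a) (by omega)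
      have hE := peakIdx_erase (a := a) hinj hb hEw
      have hE' := peakIdx_erase (a := w) hinj hb hEa
      have := ih (W := W₁ ++ W₂) (card_erase_topChoice (rk := rk) (a := w) hO)
        (by simp; omega) (by simp; omega)
      simp only [List.append_assoc, List.cons_append, List.length_append, List.length_cons]
        at this ⊢
      rw [← add_assoc, hybrid_of_pick (by omega) h1 h2, this,
        hybrid_of_pick (by omega) (h1.erase hinj hb (by omega) hEa) (by omega),
        Multiset.cons_swap, topChoice_erase_of_peakIdx_ne hinj hO' (by omega),
        topChoice_erase_of_peakIdx_ne hinj hO' (by omega), Finset.erase_right_comm]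

end Hybrid

/-- All orderings of the agents in `U`. -/
def orderings {n : ℕ} (U : Finset (Fin n)) : Finset (List (Fin n)) :=
  U.val.lists.toFinset

theorem mem_orderings {n : ℕ} {U : Finset (Fin n)} {ρ : List (Fin n)} :
    ρ ∈ orderings U ↔ U.val = ρ := by
  simp [orderings, Multiset.mem_lists_iff]

section Sums

variable {n : ℕ} {rk : Fin n → Fin n → Fin n}

theorem sum_orderings_eq_sum_erase {M : Type*} [AddCommMonoid M] {U : Finset (Fin n)}
    (hU : U.Nonempty) (f : List (Fin n) → M) :
    ∑ ρ ∈ orderings U, f ρ = ∑ a ∈ U, ∑ ρ ∈ orderings (U.erase a), f (a :: ρ) := by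
  rw [Finset.sum_sigma']
  symm
  refine Finset.sum_bij (fun p _ => p.1 :: p.2) ?_ ?_ ?_ fun _ _ => rfl
  · rintro ⟨a, ρ⟩ h
    simp only [Finset.mem_sigma, mem_orderings,
      Finset.erase_val] at h ⊢
    rw [← Multiset.cons_coe, ← h.2, Multiset.cons_erase h.1]
  · rintro ⟨a, ρ⟩ - ⟨b, τ⟩ - h
    simpa using h
  · intro ρ h
    simp only [mem_orderings] at h
    cases ρ with
    | nil => exact absurd (Finset.val_eq_zero.1 h) hU.ne_empty
    | cons a ρ =>
      have ha : a ∈ U := by rw [← Finset.mem_val, h]; simp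
      refine ⟨⟨a, ρ⟩, ?_, rfl⟩
      simp only [Finset.mem_sigma, mem_orderings,
        Finset.erase_val]
      exact ⟨ha, by rw [h]; simp⟩

theorem sum_orderings_congr_of_prefix {M : Type*} [AddCommMonoid M] (s : ℕ) {V : Finset (Fin n)}
    (hs : s ≤ V.card) {f g : List (Fin n) → M}
    (h : ∀ (W : List (Fin n)) (U : Finset (Fin n)), W.length = s → s + U.card = V.card →
      ∑ ρ ∈ orderings U, f (W ++ ρ) = ∑ ρ ∈ orderings U, g (W ++ ρ)) :
    ∑ ρ ∈ orderings V, f ρ = ∑ ρ ∈ orderings V, g ρ := by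
  induction s generalizing V f g with
  | zero => simpa using h [] V rfl (zero_add _)
  | succ s ih =>
    have hV : V.Nonempty := Finset.card_pos.1 (by omega)
    rw [sum_orderings_eq_sum_erase hV, sum_orderings_eq_sum_erase hV]
    refine Finset.sum_congr rfl fun a ha => ?_
    have hcard := Finset.card_erase_add_one ha
    refine ih (by omega) fun W U hW hU => ?_
    exact h (a :: W) U (by simp [hW]) (by omega)

theorem sum_sum_erase_comm {ι M : Type*} [DecidableEq ι] [AddCommMonoid M] (R : Finset ι)
    (F : ι → ι → M) :
    ∑ a ∈ R, ∑ e ∈ R.erase a, F e a = ∑ a ∈ R, ∑ e ∈ R.erase a, F a e := by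
  refine Finset.sum_comm' fun a e => ?_
  simp only [Finset.mem_erase]
  tauto

theorem sum_erase_eq_add {ι M : Type*} [DecidableEq ι] [AddCommMonoid M] (U : Finset ι)
    (p : ι → Prop) [DecidablePred p] (F : ι → M) (a : ι) :
    ∑ e ∈ U.erase a, F e =
      ∑ e ∈ (U.filter p).erase a, F e + ∑ e ∈ (U.filter (¬ p ·)).erase a, F e := by
  rw [← Finset.filter_erase, ← Finset.filter_erase, Finset.sum_filter_add_sum_filter_not]

/-- Moving the dictator from position `s + 1` to position `s` does not change the distribution
of outcomes when the agents from position `s` on are ordered uniformly at random. -/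
theorem sum_hybrid_succ (hinj : ∀ i, Function.Injective (rk i)) (hb : BetweenBetter rk)
    {m : ℕ} {W : List (Fin n)} {U O : Finset (Fin n)} (hO : O.card = m)
    (hm : W.length + U.card = m) (φ : Multiset (Fin n × Fin n) → ℤ) :
    ∑ ρ ∈ orderings U, φ (hybrid rk m (W.length + 1) (W ++ ρ) O) =
      ∑ ρ ∈ orderings U, φ (hybrid rk m W.length (W ++ ρ) O) := by
  induction m generalizing W U O φ with
  | zero => rfl
  | succ m ih =>
  rcases allPass_or_exists_pick (rk := rk) (O := O) W with h | ⟨W₁, w, W₂, rfl, h1, h2⟩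
  swap
  · have := ih (W := W₁ ++ W₂) (U := U) (card_erase_topChoice (rk := rk) (a := w) hO)
      (by simp at hm ⊢; omega) (fun x => φ ((w, topChoice rk w O) ::ₘ x))
    simp only [List.append_assoc, List.cons_append, List.length_append, List.length_cons]
      at this ⊢
    simp only [← add_assoc]
    convert this using 3 with ρ _ ρ _
    · rw [hybrid_of_pick (by omega) h1 h2]
    · rw [hybrid_of_pick (by omega) h1 h2]
  have hO' : O.Nonempty := Finset.card_pos.1 (by omega)
  have hU : U.Nonempty := by
    rw [← Finset.card_pos]
    by_contra! hU
    rcases List.eq_nil_or_concat W with rfl | ⟨W₃, b, rfl⟩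
    · simp at hm; omega
    · have h3 := h W₃ b [] (by simp)
      have h4 := peakIdx_lt_card (rk := rk) (a := b) hO'
      simp at hm
      omega
  rw [sum_orderings_eq_sum_erase hU, sum_orderings_eq_sum_erase hU]
  set s := W.length with hs
  have hlow : ∀ a, peakIdx rk a O ≤ s →
      ∑ ρ ∈ orderings (U.erase a), φ (hybrid rk (m + 1) (s + 1) (W ++ a :: ρ) O) =
        ∑ ρ ∈ orderings (U.erase a), φ (hybrid rk (m + 1) s (W ++ a :: ρ) O) := fun a ha => by
    refine Finset.sum_congr rfl fun ρ _ => ?_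
    rw [hybrid_succ_eq_of_peakIdx_le hinj hb hO (by have := hU.card_pos; omega) ha]
  let p : Fin n → Prop := fun a => s < peakIdx rk a O
  have : DecidablePred p := fun a => inferInstanceAs (Decidable (_ < _))
  rw [← Finset.sum_filter_add_sum_filter_not U p, ← Finset.sum_filter_add_sum_filter_not U p
    (fun a => ∑ ρ ∈ orderings (U.erase a), φ (hybrid rk (m + 1) s (W ++ a :: ρ) O))]
  congr 1
  swap
  · exact Finset.sum_congr rfl fun a ha => hlow a (not_lt.1 (Finset.mem_filter.1 ha).2)
  let X : Fin n → Fin n → ℤ := fun e a => ∑ ρ ∈ orderings ((U.erase e).erase a),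
    φ ((e, topChoice rk e O) ::ₘ
      hybrid rk m (s + 1) (W ++ a :: ρ) (O.erase (topChoice rk e O)))
  let Y : Fin n → Fin n → ℤ := fun e a => ∑ ρ ∈ orderings ((U.erase e).erase a),
    φ ((e, topChoice rk e O) ::ₘ hybrid rk m s (W ++ a :: ρ) (O.erase (topChoice rk e O)))
  have hm1 : ∀ a, p a → s + 2 ≤ m + 1 := fun a ha => by
    have := peakIdx_lt_card (rk := rk) (a := a) hO'
    simp only [p] at ha
    omega
  have herase : ∀ a ∈ U, p a → (U.erase a).Nonempty := fun a ha hpa => by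
    have h3 := hm1 a hpa
    rw [← Finset.card_pos]
    have := Finset.card_erase_add_one ha
    omega
  have hXY : ∀ e ∈ U, (U.erase e).Nonempty →
      ∑ a ∈ U.erase e, X e a = ∑ a ∈ U.erase e, Y e a := fun e he hne => by
    simp only [X, Y]
    rw [← sum_orderings_eq_sum_erase hne fun ρ => φ ((e, topChoice rk e O) ::ₘ
        hybrid rk m (s + 1) (W ++ ρ) (O.erase (topChoice rk e O))),
      ← sum_orderings_eq_sum_erase hne fun ρ => φ ((e, topChoice rk e O) ::ₘ
        hybrid rk m s (W ++ ρ) (O.erase (topChoice rk e O)))]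
    exact ih (card_erase_topChoice hO) (by have := Finset.card_erase_add_one he; omega)
      (fun x => φ ((e, topChoice rk e O) ::ₘ x))
  have hleft : ∀ a ∈ U.filter p,
      ∑ ρ ∈ orderings (U.erase a), φ (hybrid rk (m + 1) (s + 1) (W ++ a :: ρ) O) =
        ∑ e ∈ U.erase a, X e a := fun a ha => by
    obtain ⟨haU, hpa⟩ := Finset.mem_filter.1 ha
    rw [sum_orderings_eq_sum_erase (herase a haU hpa)]
    refine Finset.sum_congr rfl fun e _ => ?_
    simp only [X]
    rw [Finset.erase_right_comm]
    refine Finset.sum_congr rfl fun ρ _ => ?_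
    have := hybrid_of_allPass (k := m) (L := ρ) (a := e) (h.append_singleton hpa)
    simp only [List.length_append, List.length_singleton, List.append_assoc,
      List.singleton_append] at this
    rw [hs, this]
  have hright : ∀ a ∈ U.filter p,
      ∑ ρ ∈ orderings (U.erase a), φ (hybrid rk (m + 1) s (W ++ a :: ρ) O) =
        ∑ e ∈ U.erase a, X a e := fun a ha => by
    obtain ⟨haU, hpa⟩ := Finset.mem_filter.1 ha
    rw [hXY a haU (herase a haU hpa), sum_orderings_eq_sum_erase (herase a haU hpa)]
    refine Finset.sum_congr rfl fun e _ => Finset.sum_congr rfl fun ρ _ => ?_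
    rw [hybrid_of_allPass h]
  have hcross : ∀ e ∈ U.filter (¬ p ·),
      ∑ a ∈ U.filter p, X e a = ∑ a ∈ U.filter p, X a e := fun e he => by
    obtain ⟨heU, hpe⟩ := Finset.mem_filter.1 he
    rcases (U.filter p).eq_empty_or_nonempty with hR | ⟨a₀, ha₀⟩
    · simp [hR]
    have hsm := hm1 a₀ (Finset.mem_filter.1 ha₀).2
    obtain ⟨m, rfl⟩ : ∃ m', m = m' + 1 := ⟨m - 1, by omega⟩
    have hE : ∀ c, (O.erase (topChoice rk c O)).Nonempty :=
      fun c => erase_topChoice_nonempty (by omega)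
    have hXYp : ∑ a ∈ U.filter p, X e a = ∑ a ∈ U.filter p, Y e a := by
      have h3 := hXY e heU (by
        rw [← Finset.card_pos]
        have := Finset.card_erase_add_one heU
        omega)
      rw [sum_erase_eq_add U p, sum_erase_eq_add U p (Y e),
        Finset.erase_eq_of_notMem (s := U.filter p) (by simp [hpe])] at h3
      have h4 : ∑ a ∈ (U.filter (¬ p ·)).erase e, X e a =
          ∑ a ∈ (U.filter (¬ p ·)).erase e, Y e a := by
        refine Finset.sum_congr rfl fun a ha => Finset.sum_congr rfl fun ρ _ => ?_
        have hpa := (Finset.mem_filter.1 (Finset.mem_of_mem_erase ha)).2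
        have := peakIdx_erase (a := a) hinj hb (hE e)
        simp only [p] at hpa
        rw [hybrid_succ_eq_of_peakIdx_le hinj hb (card_erase_topChoice hO) (by omega)
          (by omega)]
      rw [h4] at h3
      exact add_right_cancel h3
    rw [hXYp]
    refine Finset.sum_congr rfl fun a ha => ?_
    have hpa := (Finset.mem_filter.1 ha).2
    simp only [X, Y, p] at hpa hpe ⊢
    rw [Finset.erase_right_comm]
    refine Finset.sum_congr rfl fun ρ _ => ?_
    have hEe := peakIdx_erase (a := a) hinj hb (hE e)
    have hEa := peakIdx_erase (a := e) hinj hb (hE a)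
    rw [hybrid_eq_cons_of_le_peakIdx hinj hb (card_erase_topChoice hO) (by omega) (by omega),
      hybrid_of_pick le_rfl (h.erase hinj hb hpa (hE a)) (by omega), Multiset.cons_swap,
      topChoice_erase_of_peakIdx_ne hinj hO' (by omega),
      topChoice_erase_of_peakIdx_ne hinj hO' (by omega), Finset.erase_right_comm]
  rw [Finset.sum_congr rfl hleft, Finset.sum_congr rfl hright]
  have hsplit : ∀ F : Fin n → Fin n → ℤ, ∑ a ∈ U.filter p, ∑ e ∈ U.erase a, F a e =
      ∑ a ∈ U.filter p, ∑ e ∈ (U.filter p).erase a, F a e +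
        ∑ e ∈ U.filter (¬ p ·), ∑ a ∈ U.filter p, F a e := fun F => by
    rw [Finset.sum_comm (s := U.filter (¬ p ·)), ← Finset.sum_add_distrib]
    refine Finset.sum_congr rfl fun a ha => ?_
    rw [sum_erase_eq_add U p,
      Finset.erase_eq_of_notMem (s := U.filter (¬ p ·)) (by simp [(Finset.mem_filter.1 ha).2])]
  rw [hsplit fun a e => X e a, hsplit X, sum_sum_erase_comm _ X, Finset.sum_congr rfl hcross]

theorem sum_hybrid_eq (hinj : ∀ i, Function.Injective (rk i)) (hb : BetweenBetter rk)
    {V O : Finset (Fin n)} (hVO : O.card = V.card) (φ : Multiset (Fin n × Fin n) → ℤ)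
    {s : ℕ} (hs : s ≤ V.card) :
    ∑ ρ ∈ orderings V, φ (hybrid rk V.card s ρ O) =
      ∑ ρ ∈ orderings V, φ (hybrid rk V.card 0 ρ O) := by
  induction s with
  | zero => rfl
  | succ s ih =>
    rw [← ih (by omega)]
    refine sum_orderings_congr_of_prefix s (by omega) fun W U hW hU => ?_
    subst hW
    exact sum_hybrid_succ hinj hb hVO hU φ

theorem sum_perm_eq_sum_orderings {M : Type*} [AddCommMonoid M] (f : List (Fin n) → M) :
    ∑ σ : Equiv.Perm (Fin n), f ((List.finRange n).map σ) =
      ∑ ρ ∈ orderings Finset.univ, f ρ := by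
  refine Finset.sum_bij (fun σ _ => (List.finRange n).map σ) ?_ ?_ ?_ fun _ _ => rfl
  · intro σ _
    rw [mem_orderings]
    refine (Multiset.Nodup.ext Finset.univ.nodup ?_).2 fun a => ?_
    · exact Multiset.coe_nodup.2 ((List.nodup_finRange n).map σ.injective)
    · simpa using ⟨σ.symm a, by simp⟩
  · intro σ _ τ _ h
    ext1 i
    exact List.map_inj_left.1 h i (List.mem_finRange i)
  · intro ρ h
    rw [mem_orderings] at h
    have hlen : ρ.length = n := by
      have := congrArg Multiset.card h
      simpa using this.symm
    have hnd : ρ.Nodup := Multiset.coe_nodup.1 (h ▸ Finset.univ.nodup)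
    have hinj : Function.Injective fun i : Fin n => ρ.get (i.cast hlen.symm) :=
      hnd.injective_get.comp (Fin.cast_injective _)
    refine ⟨Equiv.ofBijective _ (Finite.injective_iff_bijective.1 hinj), Finset.mem_univ _, ?_⟩
    apply List.ext_getElem <;> simp [hlen]

end Sums

section Algorithms

variable {n : ℕ} {rk : Fin n → Fin n → Fin n}

theorem argmin_getD_eq_topChoice (hinj : ∀ i, Function.Injective (rk i)) {a d : Fin n}
    {l : List (Fin n)} (hl : l ≠ []) : (l.argmin (rk a)).getD d = topChoice rk a l.toFinset := by
  obtain ⟨o, ho⟩ := Option.ne_none_iff_exists'.1 (mt (List.argmin_eq_none (f := rk a)).1 hl)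
  rw [ho, Option.getD_some]
  have ho' : o ∈ l.argmin (rk a) := ho
  exact (topChoice_eq hinj (by simpa using List.argmin_mem ho')
    fun x hx => List.le_of_mem_argmin (by simpa using hx) ho').symm

theorem topChoice_toFinset_mem {a : Fin n} {l : List (Fin n)} (hl : l ≠ []) :
    topChoice rk a l.toFinset ∈ l :=
  List.mem_toFinset.1 (topChoice_mem (by simpa using hl))

theorem toFinset_erase_of_nodup {α : Type*} [DecidableEq α] {l : List α} (hl : l.Nodup) (o : α) :
    (l.erase o).toFinset = l.toFinset.erase o := by
  ext x
  simp [hl.mem_erase_iff]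

theorem peakIdx_le_length_iff (hinj : ∀ i, Function.Injective (rk i)) (hb : BetweenBetter rk)
    {a o₁ o₂ : Fin n} {l₁ l₂ : List (Fin n)} (h : (l₁ ++ o₁ :: o₂ :: l₂).Pairwise (· < ·)) :
    peakIdx rk a (l₁ ++ o₁ :: o₂ :: l₂).toFinset ≤ l₁.length ↔ rk a o₁ < rk a o₂ := by
  set O := (l₁ ++ o₁ :: o₂ :: l₂).toFinset with hO
  have hne : O.Nonempty := ⟨o₁, by simp [hO]⟩
  have hsplit := List.pairwise_append.1 h
  have h₁ := List.pairwise_cons.1 hsplit.2.1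
  have h₂ := List.pairwise_cons.1 h₁.2
  have h₁₂ : o₁ < o₂ := h₁.1 o₂ (by simp)
  have hlt : ∀ x ∈ O, x < o₁ ↔ x ∈ l₁ := by
    intro x hx
    constructor
    · intro hxo
      simp only [hO, List.mem_toFinset, List.mem_append, List.mem_cons] at hx
      rcases hx with hx | rfl | rfl | hx
      · exact hx
      · exact absurd hxo (lt_irrefl _)
      · exact absurd hxo h₁₂.not_gt
      · exact absurd hxo (h₁.1 x (by simp [hx])).not_gt
    · intro hx
      exact hsplit.2.2 x hx o₁ (by simp)
  have hgt : ∀ x ∈ O, o₁ < x → o₂ ≤ x := by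
    intro x hx hxo
    simp only [hO, List.mem_toFinset, List.mem_append, List.mem_cons] at hx
    rcases hx with hx | rfl | rfl | hx
    · exact absurd hxo (hsplit.2.2 x hx o₁ (by simp)).not_gt
    · exact absurd hxo (lt_irrefl _)
    · exact le_rfl
    · exact (h₂.1 x hx).le
  have hcard : (O.filter (· < o₁)).card = l₁.length := by
    rw [← List.toFinset_card_of_nodup (l := l₁) (hsplit.1.imp fun h => h.ne)]
    congr 1
    ext x
    simp only [Finset.mem_filter, List.mem_toFinset]
    exact ⟨fun hx => (hlt x hx.1).1 hx.2,
      fun hx => ⟨by simp [hO, hx], hsplit.2.2 x hx o₁ (by simp)⟩⟩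
  have htop := topChoice_mem (rk := rk) (a := a) hne
  have hle₁ : rk a (topChoice rk a O) ≤ rk a o₁ := rk_topChoice_le (by simp [hO])
  have hle₂ : rk a (topChoice rk a O) ≤ rk a o₂ := rk_topChoice_le (by simp [hO])
  have hne₁₂ : rk a o₁ ≠ rk a o₂ := (hinj a).ne h₁₂.ne
  rw [← hcard, peakIdx]
  constructor
  · intro h'
    have hto : topChoice rk a O ≤ o₁ := by
      by_contra! hto
      refine absurd h' (not_le.2 (Finset.card_lt_card
        (Finset.ssubset_iff_of_subset (fun x hx => ?_) |>.2 ⟨o₁, ?_, ?_⟩)))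
      · simp only [Finset.mem_filter] at hx ⊢
        exact ⟨hx.1, hx.2.trans hto⟩
      · exact Finset.mem_filter.2 ⟨by simp [hO], hto⟩
      · simp
    rcases hto.eq_or_lt with heq | hlt'
    · rw [heq] at hle₂
      order
    · rcases hb a _ _ _ hlt' h₁₂ with h | h <;> order
  · intro h'
    refine Finset.card_le_card fun x hx => ?_
    simp only [Finset.mem_filter] at hx ⊢
    refine ⟨hx.1, hx.2.trans_le ?_⟩
    by_contra! hto
    rcases (hgt _ htop hto).eq_or_lt with heq | hlt'
    · rw [← heq] at hle₁
      order
    · rcases hb a _ _ _ h₁₂ hlt' with h | h <;> order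

theorem findIdx2_eq_stopIdx (hinj : ∀ i, Function.Injective (rk i)) (hb : BetweenBetter rk)
    {L l₁ l₂ : List (Fin n)} (h : (l₁ ++ l₂).Pairwise (· < ·)) (hL : L.length = l₂.length) :
    findIdx2 rk L l₂ = stopIdx rk (l₁ ++ l₂).toFinset l₁.length L := by
  induction L generalizing l₁ l₂ with
  | nil => simp [findIdx2, stopIdx]
  | cons a L ih =>
    match l₂, hL with
    | [o], hL =>
      have hcard : (l₁ ++ [o]).toFinset.card = l₁.length + 1 := by
        rw [List.toFinset_card_of_nodup (h.imp fun h => h.ne)]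
        simp
      have hlt : peakIdx rk a (l₁ ++ [o]).toFinset < (l₁ ++ [o]).toFinset.card :=
        peakIdx_lt_card ⟨o, by simp⟩
      rw [stopIdx, if_pos (by omega)]
      simp [findIdx2]
    | o₁ :: o₂ :: l₂, hL =>
      rw [findIdx2, stopIdx]
      simp only [peakIdx_le_length_iff hinj hb h]
      have := ih (l₁ := l₁ ++ [o₁]) (l₂ := o₂ :: l₂) (by simpa using h) (by simpa using hL)
      rw [this]
      simp

theorem stopIdx_lt_length {O : Finset (Fin n)} {L : List (Fin n)} {j : ℕ} (hL : L ≠ [])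
    (hO : O.card = L.length + j) : stopIdx rk O j L < L.length := by
  induction L generalizing j with
  | nil => exact absurd rfl hL
  | cons a L ih =>
    rw [stopIdx]
    split_ifs with h
    · simp
    · have hne : O.Nonempty := Finset.card_pos.1 (by rw [hO]; simp)
      have := peakIdx_lt_card (rk := rk) (a := a) hne
      simp only [List.length_cons] at hO ⊢
      have hL' : L ≠ [] := by
        rintro rfl
        simp only [List.length_nil] at hO
        omega
      have := ih (j := j + 1) hL' (by omega)
      omega

theorem coe_SPAux (hinj : ∀ i, Function.Injective (rk i)) {L l : List (Fin n)}
    (hl : l.Nodup) (hL : L.length = l.length) :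
    (SPAux rk L l : Multiset (Fin n × Fin n)) = hybrid rk L.length 0 L l.toFinset := by
  induction L generalizing l with
  | nil => simp [SPAux, hybrid]
  | cons a L ih =>
    cases l with
    | nil => simp at hL
    | cons o l =>
      have hne : o :: l ≠ [] := by simp
      simp only [SPAux, argmin_getD_eq_topChoice hinj hne, ← Multiset.cons_coe]
      rw [ih (hl.erase _)
        (by rw [List.length_erase_of_mem (topChoice_toFinset_mem hne)]; simpa using hL),
        toFinset_erase_of_nodup hl]
      simp [hybrid]

theorem coe_crawlAux (hinj : ∀ i, Function.Injective (rk i)) (hb : BetweenBetter rk)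
    {k s : ℕ} {L l : List (Fin n)} (hl : l.Pairwise (· < ·)) (hL : L.length = l.length)
    (hs : L.length ≤ s) :
    (crawlAux rk k L l : Multiset (Fin n × Fin n)) = hybrid rk k s L l.toFinset := by
  induction k generalizing L l s with
  | zero => simp [crawlAux, hybrid]
  | succ k ih =>
    match L, l, hL with
    | [], l, hL => simp [crawlAux, hybrid]
    | a :: L, o :: l, hL =>
      have hne : o :: l ≠ [] := by simp
      have hnd : (o :: l).Nodup := hl.imp fun h => h.ne
      have hidx := findIdx2_eq_stopIdx (l₁ := []) (L := a :: L) hinj hb hl hL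
      simp only [List.nil_append, List.length_nil] at hidx
      have hlt : stopIdx rk (o :: l).toFinset 0 (a :: L) < (a :: L).length :=
        stopIdx_lt_length (by simp) (by rw [List.toFinset_card_of_nodup hnd, hL]; simp)
      simp only [crawlAux, hybrid, argmin_getD_eq_topChoice hinj hne, ← Multiset.cons_coe, hidx]
      rw [min_eq_right (by omega), if_pos (by omega), ← toFinset_erase_of_nodup hnd]
      congr 1
      have hlen : ((a :: L).eraseIdx (stopIdx rk (o :: l).toFinset 0 (a :: L))).length + 1 =
          (a :: L).length := by
        rw [List.length_eraseIdx_add_one hlt]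
      refine ih (hl.sublist List.erase_sublist) ?_ (by omega)
      rw [List.length_erase_of_mem (topChoice_toFinset_mem hne), ← hL]
      omega

theorem ownersList_eq_map (ω : Equiv.Perm (Fin n)) :
    ownersList ω = (List.finRange n).map ω.symm := by
  rw [ownersList, ← List.filterMap_eq_map]
  congr 1
  funext o
  obtain ⟨a, ha⟩ : ∃ a, (List.finRange n).find? (fun a => ω a == o) = some a := by
    rw [← Option.isSome_iff_exists, List.find?_isSome]
    exact ⟨ω.symm o, by simp⟩
  have := List.find?_some ha
  simp only [beq_iff_eq] at this
  rw [ha, Function.comp_apply, ← this, Equiv.symm_apply_apply]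

theorem map_fst_SPAux {L l : List (Fin n)} (hL : L.length = l.length) :
    (SPAux rk L l).map Prod.fst = L := by
  induction L generalizing l with
  | nil => simp [SPAux]
  | cons a L ih =>
    cases l with
    | nil => simp at hL
    | cons o l =>
      obtain ⟨x, hx⟩ := Option.ne_none_iff_exists'.1
        (mt (List.argmin_eq_none (f := rk a)).1 (List.cons_ne_nil o l))
      simp only [SPAux, hx, Option.getD_some, List.map_cons]
      rw [ih (by rw [List.length_erase_of_mem (List.argmin_mem hx)]; simpa using hL)]

theorem lookup_eq_some_of_mem {α β : Type*} [DecidableEq α] {l : List (α × β)}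
    (hl : (l.map Prod.fst).Nodup) {a : α} {b : β} (h : (a, b) ∈ l) : l.lookup a = some b := by
  induction l with
  | nil => simp at h
  | cons p l ih =>
    obtain ⟨c, d⟩ := p
    simp only [List.map_cons, List.nodup_cons] at hl
    rcases List.mem_cons.1 h with h' | h'
    · simp_all
    · have hne : a ≠ c := by
        rintro rfl
        exact hl.1 (List.mem_map_of_mem (f := Prod.fst) h')
      rw [List.lookup_cons, beq_false_of_ne hne]
      exact ih hl.2 h'

theorem SinglePeaked.betweenBetter {P : Fin n → Equiv.Perm (Fin n)} (hP : SinglePeaked P) :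
    BetweenBetter fun j => ⇑(P j) := by
  intro i x y z hxy hyz
  obtain ⟨p, hp⟩ := hP i
  rcases le_total y p with h | h
  · exact Or.inl (hp y x (Or.inl ⟨hxy, h⟩))
  · exact Or.inr (hp y z (Or.inr ⟨h, hyz⟩))

/-- Sequential priority and crawler allocations agree when the corresponding multisets of
assignments do. -/
theorem SPfun_eq_CRfun_of_hybrid_eq (hinj : ∀ i, Function.Injective (rk i))
    (hb : BetweenBetter rk) {σ ω : Equiv.Perm (Fin n)}
    (h : hybrid rk n 0 ((List.finRange n).map σ) Finset.univ =
      hybrid rk n n ((List.finRange n).map ω.symm) Finset.univ) :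
    SPfun rk σ = CRfun rk ω := by
  have hsp := coe_SPAux (L := (List.finRange n).map σ) hinj (List.nodup_finRange n) (by simp)
  have hcr := coe_crawlAux (k := n) (L := (List.finRange n).map ω.symm) hinj hb
    (List.pairwise_lt_finRange n) (by simp) (s := n) (by simp)
  simp only [List.length_map, List.length_finRange, List.toFinset_finRange] at hsp hcr
  have hperm := Multiset.coe_eq_coe.1 (hsp.trans (h.trans hcr.symm))
  have hfst := map_fst_SPAux (rk := rk) (L := (List.finRange n).map σ) (l := List.finRange n)
    (by simp)
  have hnd : ((List.finRange n).map σ).Nodup := (List.nodup_finRange n).map σ.injective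
  funext i
  obtain ⟨⟨j, o⟩, hmem, hji⟩ : ∃ p ∈ SPAux rk ((List.finRange n).map σ) (List.finRange n),
      p.1 = i := by
    rw [← List.mem_map, hfst]
    exact List.mem_map.2 ⟨σ.symm i, by simp, by simp⟩
  obtain rfl : j = i := hji
  rw [SPfun, CRfun, ownersList_eq_map, lookup_eq_some_of_mem (by rw [hfst]; exact hnd) hmem,
    lookup_eq_some_of_mem ((hperm.map Prod.fst).nodup_iff.1 (by rw [hfst]; exact hnd))
      (hperm.mem_iff.1 hmem)]
  rfl

theorem card_hybrid_fiber (hinj : ∀ i, Function.Injective (rk i)) (hb : BetweenBetter rk)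
    (x : Multiset (Fin n × Fin n)) :
    Fintype.card {ω : Equiv.Perm (Fin n) //
        hybrid rk n n ((List.finRange n).map ω.symm) Finset.univ = x} =
      Fintype.card {σ : Equiv.Perm (Fin n) //
        hybrid rk n 0 ((List.finRange n).map σ) Finset.univ = x} := by
  have h := sum_hybrid_eq (V := (Finset.univ : Finset (Fin n))) (O := Finset.univ) hinj hb rfl
    (fun y => if y = x then 1 else 0) (s := n) (by simp)
  simp only [Finset.card_univ, Fintype.card_fin] at h
  rw [← sum_perm_eq_sum_orderings (fun ρ => if hybrid rk n n ρ Finset.univ = x then (1 : ℤ) else 0),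
    ← sum_perm_eq_sum_orderings (fun ρ => if hybrid rk n 0 ρ Finset.univ = x then (1 : ℤ) else 0),
    ← Equiv.sum_comp (Equiv.inv (Equiv.Perm (Fin n)))] at h
  simp only [Finset.sum_boole, Nat.cast_inj] at h
  rw [Fintype.card_subtype, Fintype.card_subtype]
  exact h

end Algorithms

/-- there is a bijection `g` from endowment profiles onto orders on the
agent set such that `SP^(g ω)(P) = CR(P,ω)` for every endowment profile `ω`. -/
theorem exists_bijection_endowments_to_orders {n : ℕ} (hn : 1 ≤ n)
    (P : Fin n → Equiv.Perm (Fin n)) (hP : SinglePeaked P) :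
    ∃ g : Equiv.Perm (Fin n) → Equiv.Perm (Fin n), Function.Bijective g ∧
      ∀ ω : Equiv.Perm (Fin n), SPfun (fun j => ⇑(P j)) ⇑(g ω) = CRfun (fun j => ⇑(P j)) ⇑ω := by
  have hinj : ∀ i, Function.Injective ⇑(P i) := fun i => (P i).injective
  have hb := hP.betweenBetter
  let e := Equiv.ofFiberEquiv fun x => Fintype.equivOfCardEq (card_hybrid_fiber hinj hb x)
  exact ⟨e, e.bijective, fun ω => SPfun_eq_CRfun_of_hybrid_eq hinj hb
    (Equiv.ofFiberEquiv_map
      (fun x => Fintype.equivOfCardEq (card_hybrid_fiber hinj hb x)) ω)⟩
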